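/- arXiv:2409.02843 — 4 statements merged into one kernel-verified Lean document; each statement's English description precedes it below -/
import Mathlib

section
/- Let m ≥ 1 and let φ : ℝ^m → ℝ be twice continuously differentiable with A := max_{1≤i≤m} sup_{x∈ℝ^m} |∂φ/∂x_i(x)| < ∞ and B := max_{1≤i,j≤m} sup_{x∈ℝ^m} |∂²φ/(∂x_i∂x_j)(x)| < ∞. Then for every q ∈ [1,2] and all a, b ∈ ℝ^m, |φ(a+b) − φ(a) − ∑_{i=1}^m (∂φ/∂x_i)(a)·b_i| ≤ max(2·A, B/2) · (∑_{i=1}^m |b_i|)^q. -/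
open MeasureTheory

namespace EuclideanSpace

variable {m : ℕ}

lemma sum_apply_single_mul (L : EuclideanSpace ℝ (Fin m) →L[ℝ] ℝ) (b : EuclideanSpace ℝ (Fin m)) :
    ∑ i, L (EuclideanSpace.single i 1) * b i = L b := by
  have hb : b = ∑ i, b i • EuclideanSpace.single i (1 : ℝ) := by
    simpa using ((EuclideanSpace.basisFun (Fin m) ℝ).sum_repr b).symm
  conv_rhs => rw [hb]
  simp [map_sum, mul_comm]

lemma abs_apply_le_mul_sum_abs {C : ℝ} (L : EuclideanSpace ℝ (Fin m) →L[ℝ] ℝ)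
    (hL : ∀ i, |L (EuclideanSpace.single i 1)| ≤ C) (b : EuclideanSpace ℝ (Fin m)) :
    |L b| ≤ C * ∑ i, |b i| := by
  rw [← sum_apply_single_mul, Finset.mul_sum]
  refine (Finset.abs_sum_le_sum_abs _ _).trans (Finset.sum_le_sum fun i _ ↦ ?_)
  rw [abs_mul]
  exact mul_le_mul_of_nonneg_right (hL i) (abs_nonneg _)

lemma abs_apply_apply_le_mul_sum_abs_sq {C : ℝ}
    (L : EuclideanSpace ℝ (Fin m) →L[ℝ] EuclideanSpace ℝ (Fin m) →L[ℝ] ℝ)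
    (hL : ∀ i j, |L (EuclideanSpace.single i 1) (EuclideanSpace.single j 1)| ≤ C)
    (b : EuclideanSpace ℝ (Fin m)) :
    |L b b| ≤ C * (∑ i, |b i|) ^ 2 := by
  have h := abs_apply_le_mul_sum_abs (L.flip b)
    (fun i ↦ abs_apply_le_mul_sum_abs (L (EuclideanSpace.single i 1)) (hL i) b) b
  rw [sq, ← mul_assoc]
  exact h

end EuclideanSpace

section Taylor

variable {E : Type*} [NormedAddCommGroup E] [NormedSpace ℝ E] {φ : E → ℝ}

lemma hasDerivAt_add_smul (a b : E) (t : ℝ) : HasDerivAt (fun t : ℝ ↦ a + t • b) b t := by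
  simpa using ((hasDerivAt_id t).smul_const b).const_add a

lemma abs_sub_le_of_abs_fderiv_apply_le (hφ : Differentiable ℝ φ) {C : ℝ} (a b : E)
    (hC : ∀ x, |fderiv ℝ φ x b| ≤ C) : |φ (a + b) - φ a| ≤ C := by
  have hd (t : ℝ) : HasDerivAt (fun t : ℝ ↦ φ (a + t • b)) (fderiv ℝ φ (a + t • b) b) t :=
    (hφ _).hasFDerivAt.comp_hasDerivAt t (hasDerivAt_add_smul a b t)
  have h := norm_image_sub_le_of_norm_deriv_le_segment_01'
    (fun t _ ↦ (hd t).hasDerivWithinAt) (fun t _ ↦ hC (a + t • b))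
  simpa using h

lemma abs_taylor_two_le (hφ : ContDiff ℝ 2 φ) {C : ℝ} (a b : E)
    (hC : ∀ x, |fderiv ℝ (fderiv ℝ φ) x b b| ≤ C) :
    |φ (a + b) - φ a - fderiv ℝ φ a b| ≤ C / 2 := by
  have hφ1 : Differentiable ℝ φ := hφ.differentiable (by norm_num)
  have hφ2 : Differentiable ℝ (fderiv ℝ φ) :=
    (hφ.fderiv_right (m := 1) (by norm_num)).differentiable (by norm_num)
  have hd2 (t : ℝ) : HasDerivAt (fun t : ℝ ↦ fderiv ℝ φ (a + t • b) b)
      (fderiv ℝ (fderiv ℝ φ) (a + t • b) b b) t := by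
    have h := (hφ2 _).hasFDerivAt.comp_hasDerivAt t (hasDerivAt_add_smul a b t)
    simpa using h.clm_apply (hasDerivAt_const t b)
  have hd1 (t : ℝ) : HasDerivAt (fun t : ℝ ↦ φ (a + t • b) - φ a - t * fderiv ℝ φ a b)
      (fderiv ℝ φ (a + t • b) b - fderiv ℝ φ a b) t := by
    have h := (hφ1 _).hasFDerivAt.comp_hasDerivAt t (hasDerivAt_add_smul a b t)
    exact ((h.sub_const (φ a)).sub ((hasDerivAt_id t).mul_const (fderiv ℝ φ a b))).congr_deriv
      (by simp)
  have hbound (t : ℝ) (ht : t ∈ Set.Ico (0 : ℝ) 1) :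
      ‖fderiv ℝ φ (a + t • b) b - fderiv ℝ φ a b‖ ≤ C * t := by
    have h := norm_image_sub_le_of_norm_deriv_le_segment'
      (fun s _ ↦ (hd2 s).hasDerivWithinAt) (fun s _ ↦ hC (a + s • b)) t
      (Set.right_mem_Icc.2 ht.1)
    simpa using h
  have hB (t : ℝ) : HasDerivAt (fun t : ℝ ↦ C / 2 * t ^ 2) (C * t) t := by
    refine ((hasDerivAt_pow 2 t).const_mul (C / 2)).congr_deriv ?_
    simp
    ring
  have h := image_norm_le_of_norm_deriv_right_le_deriv_boundary
    (fun t _ ↦ (hd1 t).continuousAt.continuousWithinAt)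
    (fun t _ ↦ (hd1 t).hasDerivWithinAt) (by simp) hB hbound
    (Set.right_mem_Icc.2 zero_le_one)
  simpa using h

end Taylor

lemma le_max_mul_rpow {r α β S q : ℝ} (hα : 0 ≤ α) (hS : 0 ≤ S) (hq1 : 1 ≤ q) (hq2 : q ≤ 2)
    (h1 : r ≤ α * S) (h2 : r ≤ β * S ^ 2) : r ≤ max α β * S ^ q := by
  have hM : 0 ≤ max α β := hα.trans (le_max_left _ _)
  rcases le_total S 1 with h | h
  · have hSq : S ^ 2 ≤ S ^ q := by
      rw [← Real.rpow_two]
      exact Real.rpow_le_rpow_of_exponent_ge_of_imp hS h hq2 (by intros; linarith)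
    calc r ≤ β * S ^ 2 := h2
      _ ≤ max α β * S ^ 2 := by gcongr; exact le_max_right _ _
      _ ≤ max α β * S ^ q := by gcongr
  · calc r ≤ α * S := h1
      _ ≤ max α β * S := by gcongr; exact le_max_left _ _
      _ ≤ max α β * S ^ q := by gcongr; exact Real.self_le_rpow_of_one_le h hq1

/-- Lemma 3.1: Taylor remainder bound with exponent `q ∈ [1,2]` for a C² function
with bounded first and second partial derivatives. -/
theorem remainder_q_bound (m : ℕ) (hm : 1 ≤ m)
    (φ : EuclideanSpace ℝ (Fin m) → ℝ) (hφ : ContDiff ℝ 2 φ)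
    (A B : ℝ)
    (hA : ∀ (i : Fin m) (x : EuclideanSpace ℝ (Fin m)),
      |fderiv ℝ φ x (EuclideanSpace.single i 1)| ≤ A)
    (hB : ∀ (i j : Fin m) (x : EuclideanSpace ℝ (Fin m)),
      |iteratedFDeriv ℝ 2 φ x ![EuclideanSpace.single i 1, EuclideanSpace.single j 1]| ≤ B)
    (q : ℝ) (hq1 : 1 ≤ q) (hq2 : q ≤ 2)
    (a b : EuclideanSpace ℝ (Fin m)) :
    |φ (a + b) - φ a - ∑ i : Fin m, fderiv ℝ φ a (EuclideanSpace.single i 1) * b i|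
      ≤ max (2 * A) (B / 2) * (∑ i : Fin m, |b i|) ^ q := by
  have hA0 : 0 ≤ A := (abs_nonneg _).trans (hA ⟨0, hm⟩ 0)
  rw [EuclideanSpace.sum_apply_single_mul]
  have hAb (x : EuclideanSpace ℝ (Fin m)) : |fderiv ℝ φ x b| ≤ A * ∑ i, |b i| :=
    EuclideanSpace.abs_apply_le_mul_sum_abs _ (fun i ↦ hA i x) b
  have hBb (x : EuclideanSpace ℝ (Fin m)) :
      |fderiv ℝ (fderiv ℝ φ) x b b| ≤ B * (∑ i, |b i|) ^ 2 :=
    EuclideanSpace.abs_apply_apply_le_mul_sum_abs_sq _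
      (fun i j ↦ by simpa [iteratedFDeriv_two_apply] using hB i j x) b
  refine le_max_mul_rpow (by positivity) (by positivity) hq1 hq2 ?_ ?_
  · have h := abs_sub_le_of_abs_fderiv_apply_le (hφ.differentiable (by norm_num)) a b hAb
    linarith [abs_sub (φ (a + b) - φ a) (fderiv ℝ φ a b), hAb a]
  · linarith [abs_taylor_two_le hφ a b hBb]
end

section
/- Let W_1, …, W_m ⊂ ℝ^d be convex bodies such that for each 1 ≤ i ≤ m−1 the set W_i \ ⋃_{j>i} W_j is nonempty. Then the m×m matrix C with entries C_{ij} = vol(W_i ∩ W_j) is positive definite. -/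
open MeasureTheory Matrix

/-- Indicators of sets of finite measure are linearly independent in `L²` as soon as each set has
a part of positive measure that avoids all the later sets. -/
theorem linearIndependent_indicatorConstLp_of_measure_diff_ne_zero {α ι : Type*}
    [MeasurableSpace α] {μ : Measure α} [Fintype ι] [LinearOrder ι] {s : ι → Set α}
    (hs : ∀ i, MeasurableSet (s i)) (hμ : ∀ i, μ (s i) ≠ ⊤)
    (hpos : ∀ i, μ (s i \ ⋃ j ∈ Set.Ioi i, s j) ≠ 0) :
    LinearIndependent ℝ fun i => indicatorConstLp 2 (hs i) (hμ i) (1 : ℝ) := by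
  rw [Fintype.linearIndependent_iff]
  intro g hg
  have hsum : ∀ᵐ x ∂μ, ∑ i, g i * (s i).indicator (fun _ => (1 : ℝ)) x = 0 := by
    have hzero := Lp.coeFn_finsetSum (p := 2) (μ := μ) Finset.univ
      fun i => g i • indicatorConstLp 2 (hs i) (hμ i) (1 : ℝ)
    rw [hg] at hzero
    have hsmul : ∀ᵐ x ∂μ, ∀ i, (g i • indicatorConstLp 2 (hs i) (hμ i) (1 : ℝ) : Lp ℝ 2 μ) x =
        g i * (s i).indicator (fun _ => (1 : ℝ)) x := by
      rw [ae_all_iff]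
      intro i
      filter_upwards [Lp.coeFn_smul (g i) (indicatorConstLp 2 (hs i) (hμ i) (1 : ℝ)),
        indicatorConstLp_coeFn (p := 2) (hs := hs i) (hμs := hμ i) (c := (1 : ℝ))] with x h₁ h₂
      rw [h₁, Pi.smul_apply, h₂, smul_eq_mul]
    filter_upwards [hzero, hsmul, Lp.coeFn_zero ℝ 2 μ] with x h₁ h₂ h₃
    rw [h₃, Finset.sum_apply] at h₁
    simpa [h₂] using h₁.symm
  intro i
  induction i using WellFoundedLT.induction with
  | ind i ih =>
    obtain ⟨x, ⟨hxi, hxj⟩, hx⟩ :=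
      ((frequently_ae_mem_iff.mpr (hpos i)).and_eventually hsum).exists
    rw [Finset.sum_eq_single i] at hx
    · simpa [hxi] using hx
    · intro j _ hji
      rcases lt_or_gt_of_ne hji with h | h
      · rw [ih j h, zero_mul]
      · have hj : x ∉ s j := fun hj => hxj (Set.mem_biUnion h hj)
        simp [hj]
    · simp

/-- A convex set with nonempty interior that is not contained in a closed set has a part of
positive measure outside of it. -/
theorem Convex.measure_diff_ne_zero {E : Type*} [NormedAddCommGroup E] [NormedSpace ℝ E]
    [MeasurableSpace E] {μ : Measure E} [μ.IsOpenPosMeasure] {s t : Set E} (hs : Convex ℝ s)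
    (hint : (interior s).Nonempty) (ht : IsClosed t) (hst : (s \ t).Nonempty) :
    μ (s \ t) ≠ 0 := by
  obtain ⟨x, hxs, hxt⟩ := hst
  have hx : x ∈ closure (interior s) := by
    rw [hs.closure_interior_eq_closure_of_nonempty_interior hint]
    exact subset_closure hxs
  have hne : (interior s ∩ tᶜ).Nonempty := by
    rw [Set.inter_comm]
    exact mem_closure_iff.mp hx _ ht.isOpen_compl hxt
  exact ((isOpen_interior.inter ht.isOpen_compl).measure_pos μ hne).ne' ∘
    measure_mono_null (Set.inter_subset_inter_left _ interior_subset)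

/-- If the convex bodies `W₁, …, Wₘ` satisfy that, for each `1 ≤ i ≤ m-1`, the set
`Wᵢ \ ⋃_{j>i} Wⱼ` is nonempty, then the matrix of volumes of pairwise
intersections is positive definite. -/
theorem intersection_volume_matrix_posdef_of_ordered (d m : ℕ)
    (W : Fin m → Set (EuclideanSpace ℝ (Fin d)))
    (hcomp : ∀ i, IsCompact (W i))
    (hconv : ∀ i, Convex ℝ (W i))
    (hint : ∀ i, (interior (W i)).Nonempty)
    (hsep : ∀ i : Fin m, (i : ℕ) < m - 1 →
      (W i \ ⋃ j ∈ Set.Ioi i, W j).Nonempty) :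
    Matrix.PosDef (Matrix.of fun i j : Fin m => (volume (W i ∩ W j)).toReal) := by
  have hmeas i : MeasurableSet (W i) := (hcomp i).measurableSet
  have hfin i : volume (W i) ≠ ⊤ := (hcomp i).measure_ne_top
  have hne (i : Fin m) : (W i \ ⋃ j ∈ Set.Ioi i, W j).Nonempty := by
    by_cases hi : (i : ℕ) < m - 1
    · exact hsep i hi
    · have hempty : Set.Ioi i = ∅ := by
        ext j
        simp only [Set.mem_Ioi, Set.mem_empty_iff_false, iff_false, Fin.lt_def]
        lia
      simpa [hempty] using (hint i).mono interior_subset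
  have hpos (i : Fin m) : volume (W i \ ⋃ j ∈ Set.Ioi i, W j) ≠ 0 :=
    (hconv i).measure_diff_ne_zero (hint i)
      ((Set.toFinite _).isClosed_biUnion fun j _ => (hcomp j).isClosed) (hne i)
  have hgram : Matrix.of (fun i j : Fin m => (volume (W i ∩ W j)).toReal) =
      gram ℝ fun i => indicatorConstLp 2 (hmeas i) (hfin i) (1 : ℝ) := by
    ext i j
    exact (L2.real_inner_indicatorConstLp_one_indicatorConstLp_one
      (hmeas i) (hmeas j) (hfin i) (hfin j)).symm
  rw [hgram]
  exact posDef_gram_of_linearIndependent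
    (linearIndependent_indicatorConstLp_of_measure_diff_ne_zero hmeas hfin hpos)
end

section
/- In ℝ², let W_1 = [0, 4/5] × [0, 1], W_2 = [0, 1] × [1/5, 1], W_3 = [1/5, 1] × [0, 1] and W_4 = [0, 1] × [0, 4/5]. Then the indicator functions 1_{W_1}, …, 1_{W_4} are linearly independent in L²(ℝ²), i.e. if x ∈ ℝ⁴ satisfies ∑_{i=1}^4 x_i · 1_{W_i}(z) = 0 for Lebesgue-almost every z ∈ ℝ², then x = 0; nevertheless, each W_i is contained in the union ⋃_{j≠i} W_j of the other three sets. -/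
open MeasureTheory

/-- A property that holds almost everywhere on the plane holds somewhere in every nonempty open
rectangle. -/
theorem exists_mem_rectangle_of_ae {p : EuclideanSpace ℝ (Fin 2) → Prop}
    (hp : ∀ᵐ z ∂(volume : Measure (EuclideanSpace ℝ (Fin 2))), p z) {a b c d : ℝ}
    (hab : a < b) (hcd : c < d) :
    ∃ z, p z ∧ (a < z 0 ∧ z 0 < b) ∧ (c < z 1 ∧ z 1 < d) := by
  have hopen : IsOpen {z : EuclideanSpace ℝ (Fin 2) |
      z 0 ∈ Set.Ioo a b ∧ z 1 ∈ Set.Ioo c d} :=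
    (isOpen_Ioo.preimage (by fun_prop : Continuous fun z : EuclideanSpace ℝ (Fin 2) => z 0)).inter
      (isOpen_Ioo.preimage (by fun_prop : Continuous fun z : EuclideanSpace ℝ (Fin 2) => z 1))
  obtain ⟨u, hu⟩ := exists_between hab
  obtain ⟨v, hv⟩ := exists_between hcd
  obtain ⟨z, hz, hpz⟩ := (Measure.dense_of_ae hp).inter_open_nonempty _ hopen
    ⟨!₂[u, v], by simpa using ⟨hu, hv⟩⟩
  exact ⟨z, hpz, hz⟩

/-- The four rectangles `W₁ = [0,4/5]×[0,1]`, `W₂ = [0,1]×[1/5,1]`,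
`W₃ = [1/5,1]×[0,1]`, `W₄ = [0,1]×[0,4/5]` have linearly independent indicator
functions in `L²(ℝ²)`, yet each of them is contained in the union of the other
three. -/
theorem four_rectangles_indicators_independent
    (W : Fin 4 → Set (EuclideanSpace ℝ (Fin 2)))
    (hW0 : W 0 = {z | z 0 ∈ Set.Icc (0 : ℝ) (4 / 5) ∧ z 1 ∈ Set.Icc (0 : ℝ) 1})
    (hW1 : W 1 = {z | z 0 ∈ Set.Icc (0 : ℝ) 1 ∧ z 1 ∈ Set.Icc (1 / 5 : ℝ) 1})
    (hW2 : W 2 = {z | z 0 ∈ Set.Icc (1 / 5 : ℝ) 1 ∧ z 1 ∈ Set.Icc (0 : ℝ) 1})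
    (hW3 : W 3 = {z | z 0 ∈ Set.Icc (0 : ℝ) 1 ∧ z 1 ∈ Set.Icc (0 : ℝ) (4 / 5)}) :
    (∀ x : Fin 4 → ℝ,
        (∀ᵐ z : EuclideanSpace ℝ (Fin 2) ∂volume,
            ∑ i : Fin 4, x i * (W i).indicator (fun _ => (1 : ℝ)) z = 0) → x = 0)
      ∧ ∀ i : Fin 4, W i ⊆ ⋃ j ∈ {j : Fin 4 | j ≠ i}, W j := by
  constructor
  · intro x hx
    have bottom_left : x 0 + x 3 = 0 := by
      obtain ⟨z, hz, ⟨h1, h2⟩, h3, h4⟩ := exists_mem_rectangle_of_ae hx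
        (show (0 : ℝ) < 1 / 5 by norm_num) (show (0 : ℝ) < 1 / 5 by norm_num)
      have m0 : z ∈ W 0 := by
        rw [hW0]
        exact ⟨⟨by linarith, by linarith⟩, by linarith, by linarith⟩
      have m1 : z ∉ W 1 := by
        rw [hW1]
        exact fun h => by linarith [h.1.1, h.1.2, h.2.1, h.2.2]
      have m2 : z ∉ W 2 := by
        rw [hW2]
        exact fun h => by linarith [h.1.1, h.1.2, h.2.1, h.2.2]
      have m3 : z ∈ W 3 := by
        rw [hW3]
        exact ⟨⟨by linarith, by linarith⟩, by linarith, by linarith⟩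
      simpa [Fin.sum_univ_four, m0, m1, m2, m3] using hz
    have top_left : x 0 + x 1 = 0 := by
      obtain ⟨z, hz, ⟨h1, h2⟩, h3, h4⟩ := exists_mem_rectangle_of_ae hx
        (show (0 : ℝ) < 1 / 5 by norm_num) (show (4 / 5 : ℝ) < 1 by norm_num)
      have m0 : z ∈ W 0 := by
        rw [hW0]
        exact ⟨⟨by linarith, by linarith⟩, by linarith, by linarith⟩
      have m1 : z ∈ W 1 := by
        rw [hW1]
        exact ⟨⟨by linarith, by linarith⟩, by linarith, by linarith⟩
      have m2 : z ∉ W 2 := by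
        rw [hW2]
        exact fun h => by linarith [h.1.1, h.1.2, h.2.1, h.2.2]
      have m3 : z ∉ W 3 := by
        rw [hW3]
        exact fun h => by linarith [h.1.1, h.1.2, h.2.1, h.2.2]
      simpa [Fin.sum_univ_four, m0, m1, m2, m3] using hz
    have middle_left : x 0 + x 1 + x 3 = 0 := by
      obtain ⟨z, hz, ⟨h1, h2⟩, h3, h4⟩ := exists_mem_rectangle_of_ae hx
        (show (0 : ℝ) < 1 / 5 by norm_num) (show (1 / 5 : ℝ) < 4 / 5 by norm_num)
      have m0 : z ∈ W 0 := by
        rw [hW0]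
        exact ⟨⟨by linarith, by linarith⟩, by linarith, by linarith⟩
      have m1 : z ∈ W 1 := by
        rw [hW1]
        exact ⟨⟨by linarith, by linarith⟩, by linarith, by linarith⟩
      have m2 : z ∉ W 2 := by
        rw [hW2]
        exact fun h => by linarith [h.1.1, h.1.2, h.2.1, h.2.2]
      have m3 : z ∈ W 3 := by
        rw [hW3]
        exact ⟨⟨by linarith, by linarith⟩, by linarith, by linarith⟩
      simpa [Fin.sum_univ_four, m0, m1, m2, m3] using hz
    have bottom_right : x 2 + x 3 = 0 := by
      obtain ⟨z, hz, ⟨h1, h2⟩, h3, h4⟩ := exists_mem_rectangle_of_ae hx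
        (show (4 / 5 : ℝ) < 1 by norm_num) (show (0 : ℝ) < 1 / 5 by norm_num)
      have m0 : z ∉ W 0 := by
        rw [hW0]
        exact fun h => by linarith [h.1.1, h.1.2, h.2.1, h.2.2]
      have m1 : z ∉ W 1 := by
        rw [hW1]
        exact fun h => by linarith [h.1.1, h.1.2, h.2.1, h.2.2]
      have m2 : z ∈ W 2 := by
        rw [hW2]
        exact ⟨⟨by linarith, by linarith⟩, by linarith, by linarith⟩
      have m3 : z ∈ W 3 := by
        rw [hW3]
        exact ⟨⟨by linarith, by linarith⟩, by linarith, by linarith⟩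
      simpa [Fin.sum_univ_four, m0, m1, m2, m3] using hz
    funext i
    fin_cases i <;> simp <;> linarith
  · intro i z hz
    simp only [Set.mem_iUnion, Set.mem_ofPred_eq, exists_prop]
    fin_cases i
    · replace hz : z ∈ W 0 := hz
      rw [hW0] at hz
      obtain ⟨⟨h1, h2⟩, h3, h4⟩ := hz
      rcases le_total (1 / 5) (z 1) with h | h
      · refine ⟨1, by decide, ?_⟩
        rw [hW1]
        exact ⟨⟨by linarith, by linarith⟩, by linarith, by linarith⟩
      · refine ⟨3, by decide, ?_⟩
        rw [hW3]
        exact ⟨⟨by linarith, by linarith⟩, by linarith, by linarith⟩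
    · replace hz : z ∈ W 1 := hz
      rw [hW1] at hz
      obtain ⟨⟨h1, h2⟩, h3, h4⟩ := hz
      rcases le_total (1 / 5) (z 0) with h | h
      · refine ⟨2, by decide, ?_⟩
        rw [hW2]
        exact ⟨⟨by linarith, by linarith⟩, by linarith, by linarith⟩
      · refine ⟨0, by decide, ?_⟩
        rw [hW0]
        exact ⟨⟨by linarith, by linarith⟩, by linarith, by linarith⟩
    · replace hz : z ∈ W 2 := hz
      rw [hW2] at hz
      obtain ⟨⟨h1, h2⟩, h3, h4⟩ := hz
      rcases le_total (1 / 5) (z 1) with h | h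
      · refine ⟨1, by decide, ?_⟩
        rw [hW1]
        exact ⟨⟨by linarith, by linarith⟩, by linarith, by linarith⟩
      · refine ⟨3, by decide, ?_⟩
        rw [hW3]
        exact ⟨⟨by linarith, by linarith⟩, by linarith, by linarith⟩
    · replace hz : z ∈ W 3 := hz
      rw [hW3] at hz
      obtain ⟨⟨h1, h2⟩, h3, h4⟩ := hz
      rcases le_total (1 / 5) (z 0) with h | h
      · refine ⟨2, by decide, ?_⟩
        rw [hW2]
        exact ⟨⟨by linarith, by linarith⟩, by linarith, by linarith⟩
      · refine ⟨0, by decide, ?_⟩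
        rw [hW0]
        exact ⟨⟨by linarith, by linarith⟩, by linarith, by linarith⟩
end

section
/- Let V, W ⊂ ℝ^d be convex bodies such that V ∩ W has nonempty interior, let α > −d, let ε > 0, and let γ > 0 be a constant such that vol((V∩W) \ (V∩W)_ε) ≤ γ·ε, where (V∩W)_ε := {x ∈ V∩W : dist(x, ∂(V∩W)) > ε} is the inner parallel set. Then | ∫_{V∩W} (∫_V 1{‖x−y‖<ε}·‖x−y‖^α dx) · (∫_W 1{‖w−y‖<ε}·‖w−y‖^α dw) dy − vol(V∩W) · (d·κ_d/(d+α))² · ε^{2d+2α} | ≤ γ · (d·κ_d/(d+α))² · ε^{2d+2α+1}. -/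
open MeasureTheory

/-- The truncated power `r ↦ r ^ α` on `r < ε`, extended by zero. -/
noncomputable def truncatedPower (α ε r : ℝ) : ℝ := if r < ε then r ^ α else 0

lemma measurable_truncatedPower (α ε : ℝ) : Measurable (truncatedPower α ε) :=
  Measurable.ite measurableSet_Iio (by fun_prop) measurable_const

lemma truncatedPower_nonneg (α ε : ℝ) {r : ℝ} (hr : 0 ≤ r) : 0 ≤ truncatedPower α ε r := by
  unfold truncatedPower
  split_ifs <;> positivity

lemma pow_smul_truncatedPower {n : ℕ} (hn : n ≠ 0) (α ε : ℝ) {r : ℝ} (hr : 0 < r) :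
    r ^ (n - 1) • truncatedPower α ε r
      = (Set.Iio ε).indicator (fun r : ℝ ↦ r ^ ((n : ℝ) + α - 1)) r := by
  have hexp : (n : ℝ) + α - 1 = ((n - 1 : ℕ) : ℝ) + α := by
    rw [Nat.cast_pred (Nat.pos_of_ne_zero hn)]
    ring
  by_cases h : r < ε
  · simp [truncatedPower, h, hexp, Real.rpow_add hr]
  · simp [truncatedPower, h]

lemma integrableOn_pow_smul_truncatedPower {n : ℕ} (hn : n ≠ 0) {α ε : ℝ} (hα : -(n : ℝ) < α)
    (hε : 0 < ε) :
    IntegrableOn (fun r : ℝ ↦ r ^ (n - 1) • truncatedPower α ε r) (Set.Ioi 0) := by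
  rw [integrableOn_congr_fun (s := Set.Ioi 0)
    (fun r hr ↦ pow_smul_truncatedPower hn α ε hr) measurableSet_Ioi]
  have h := intervalIntegral.intervalIntegrable_rpow' (a := 0) (b := ε)
    (r := (n : ℝ) + α - 1) (by linarith)
  rw [intervalIntegrable_iff_integrableOn_Ioo_of_le hε.le] at h
  rw [IntegrableOn, integrable_indicator_iff measurableSet_Iio, IntegrableOn,
    Measure.restrict_restrict measurableSet_Iio, Set.inter_comm, Set.Ioi_inter_Iio]
  exact h

lemma integral_pow_smul_truncatedPower {n : ℕ} (hn : n ≠ 0) {α ε : ℝ} (hα : -(n : ℝ) < α)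
    (hε : 0 < ε) :
    ∫ r in Set.Ioi (0 : ℝ), r ^ (n - 1) • truncatedPower α ε r
      = ε ^ ((n : ℝ) + α) / ((n : ℝ) + α) := by
  rw [setIntegral_congr_fun measurableSet_Ioi fun r hr ↦ pow_smul_truncatedPower hn α ε hr,
    setIntegral_indicator measurableSet_Iio, Set.Ioi_inter_Iio, ← integral_Ioc_eq_integral_Ioo,
    ← intervalIntegral.integral_of_le hε.le, integral_rpow (Or.inl (by linarith)),
    sub_add_cancel, Real.zero_rpow (by linarith), sub_zero]

section Euclidean

variable {d : ℕ} {α ε : ℝ}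

local notation "𝔼" => EuclideanSpace ℝ (Fin d)

lemma truncatedPower_norm_eq_zero (hd : d = 0) (hα : -(d : ℝ) < α) (x : 𝔼) :
    truncatedPower α ε ‖x‖ = 0 := by
  subst hd
  have hα' : α ≠ 0 := by
    rintro rfl
    simp at hα
  simp [truncatedPower, Subsingleton.elim x 0, Real.zero_rpow hα']

lemma integrable_truncatedPower_norm (hα : -(d : ℝ) < α) (hε : 0 < ε) :
    Integrable (fun x : 𝔼 ↦ truncatedPower α ε ‖x‖) := by
  rcases eq_or_ne d 0 with hd | hd
  · simp [truncatedPower_norm_eq_zero hd hα]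
  · have : NeZero d := ⟨hd⟩
    rw [integrable_fun_norm_addHaar, finrank_euclideanSpace_fin]
    exact integrableOn_pow_smul_truncatedPower hd hα hε

lemma integral_truncatedPower_norm (hα : -(d : ℝ) < α) (hε : 0 < ε) :
    ∫ x : 𝔼, truncatedPower α ε ‖x‖
      = d * volume.real (Metric.ball (0 : 𝔼) 1) / (d + α) * ε ^ ((d : ℝ) + α) := by
  rcases eq_or_ne d 0 with hd | hd
  · simp [truncatedPower_norm_eq_zero hd hα, hd]
  · have : NeZero d := ⟨hd⟩
    rw [integral_fun_norm_addHaar, finrank_euclideanSpace_fin,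
      integral_pow_smul_truncatedPower hd hα hε, nsmul_eq_mul, smul_eq_mul]
    ring

variable (α ε) in
lemma stronglyMeasurable_setIntegral_truncatedPower (s : Set 𝔼) :
    StronglyMeasurable fun y : 𝔼 ↦ ∫ x in s, truncatedPower α ε ‖x - y‖ := by
  refine StronglyMeasurable.integral_prod_right
    (f := fun y x : 𝔼 ↦ truncatedPower α ε ‖x - y‖) (Measurable.stronglyMeasurable ?_)
  exact (measurable_truncatedPower α ε).comp (by fun_prop)

variable (α ε) in
lemma setIntegral_truncatedPower_nonneg (s : Set 𝔼) (y : 𝔼) :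
    0 ≤ ∫ x in s, truncatedPower α ε ‖x - y‖ :=
  integral_nonneg fun _ ↦ truncatedPower_nonneg α ε (norm_nonneg _)

lemma setIntegral_truncatedPower_le (hα : -(d : ℝ) < α) (hε : 0 < ε) (s : Set 𝔼) (y : 𝔼) :
    ∫ x in s, truncatedPower α ε ‖x - y‖ ≤ ∫ x : 𝔼, truncatedPower α ε ‖x‖ := by
  rw [← integral_sub_right_eq_self (fun x : 𝔼 ↦ truncatedPower α ε ‖x‖) y]
  exact setIntegral_le_integral ((integrable_truncatedPower_norm hα hε).comp_sub_right y)
    (.of_forall fun _ ↦ truncatedPower_nonneg α ε (norm_nonneg _))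

lemma setIntegral_truncatedPower_of_ball_subset {s : Set 𝔼} {y : 𝔼}
    (h : Metric.ball y ε ⊆ s) :
    ∫ x in s, truncatedPower α ε ‖x - y‖ = ∫ x : 𝔼, truncatedPower α ε ‖x‖ := by
  rw [← integral_sub_right_eq_self (fun x : 𝔼 ↦ truncatedPower α ε ‖x‖) y]
  refine setIntegral_eq_integral_of_forall_compl_eq_zero fun x hx ↦ if_neg fun hlt ↦ hx (h ?_)
  rwa [Metric.mem_ball, dist_eq_norm]

end Euclidean

lemma ball_subset_of_lt_infDist_frontier {E : Type*} [SeminormedAddCommGroup E] [NormedSpace ℝ E]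
    {K : Set E} {y : E} {ε : ℝ} (hε : 0 < ε) (hy : y ∈ K)
    (h : ε < Metric.infDist y (frontier K)) : Metric.ball y ε ⊆ K := by
  have hdisj : ∀ x ∈ Metric.ball y ε, x ∉ frontier K := fun x hx hxf ↦ by
    have := Metric.infDist_le_dist_of_mem (x := y) hxf
    rw [Metric.mem_ball'] at hx
    linarith
  have hyi : y ∈ interior K := by
    by_contra hn
    exact hdisj y (Metric.mem_ball_self hε) ⟨subset_closure hy, hn⟩
  refine Set.Subset.trans ?_ interior_subset
  refine IsPreconnected.subset_left_of_subset_union isOpen_interior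
    (isClosed_closure (s := K)).isOpen_compl ?_ ?_ ⟨y, Metric.mem_ball_self hε, hyi⟩
    (convex_ball y ε).isPreconnected
  · exact disjoint_compl_right.mono_left interior_subset_closure
  · intro x hx
    by_contra hn
    simp only [Set.mem_union, Set.mem_compl_iff, not_or, not_not] at hn
    exact hdisj x hx ⟨hn.2, hn.1⟩

/-- Asymptotics of the triple integral appearing in the covariance computation:
`| ∫_{V∩W} (∫_V 1{‖x-y‖<ε} ‖x-y‖^α dx)(∫_W 1{‖w-y‖<ε} ‖w-y‖^α dw) dy
   − vol(V∩W) (d κ_d/(d+α))² ε^{2d+2α} | ≤ γ (d κ_d/(d+α))² ε^{2d+2α+1}`. -/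
theorem triple_integral_asymptotics (d : ℕ)
    (V W : Set (EuclideanSpace ℝ (Fin d)))
    (hVc : IsCompact V) (hVconv : Convex ℝ V) (hVint : (interior V).Nonempty)
    (hWc : IsCompact W) (hWconv : Convex ℝ W) (hWint : (interior W).Nonempty)
    (hint : (interior (V ∩ W)).Nonempty)
    (α : ℝ) (hα : -(d : ℝ) < α) (ε : ℝ) (hε : 0 < ε)
    (γ : ℝ) (hγ : 0 < γ)
    (hγ2 : (volume ((V ∩ W) \
        {x ∈ V ∩ W | ε < Metric.infDist x (frontier (V ∩ W))})).toReal ≤ γ * ε)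
    (κ : ℝ) (hκ : κ = (volume (Metric.ball (0 : EuclideanSpace ℝ (Fin d)) 1)).toReal) :
    |(∫ y in V ∩ W,
          (∫ x in V, if ‖x - y‖ < ε then ‖x - y‖ ^ α else 0) *
            (∫ w in W, if ‖w - y‖ < ε then ‖w - y‖ ^ α else 0))
        - (volume (V ∩ W)).toReal * ((d : ℝ) * κ / ((d : ℝ) + α)) ^ 2
            * ε ^ (2 * (d : ℝ) + 2 * α)|
      ≤ γ * ((d : ℝ) * κ / ((d : ℝ) + α)) ^ 2 * ε ^ (2 * (d : ℝ) + 2 * α + 1) := by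
  change |(∫ y in V ∩ W, (∫ x in V, truncatedPower α ε ‖x - y‖) *
    ∫ w in W, truncatedPower α ε ‖w - y‖) - _| ≤ _
  set A := ∫ x : EuclideanSpace ℝ (Fin d), truncatedPower α ε ‖x‖ with hA
  have hsq : ((d : ℝ) * κ / (d + α)) ^ 2 * ε ^ (2 * (d : ℝ) + 2 * α) = A ^ 2 := by
    rw [hA, integral_truncatedPower_norm hα hε, hκ, Measure.real, mul_pow _ (ε ^ _),
      ← Real.rpow_mul_natCast hε.le]
    congr 2
    push_cast
    ring
  rw [Real.rpow_add hε _ 1, Real.rpow_one, ← mul_assoc, mul_assoc γ, mul_assoc (ENNReal.toReal _),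
    hsq]
  set F := fun y ↦ (∫ x in V, truncatedPower α ε ‖x - y‖) *
    ∫ w in W, truncatedPower α ε ‖w - y‖ with hF
  have hF_nonneg y : 0 ≤ F y := mul_nonneg
    (setIntegral_truncatedPower_nonneg α ε V y) (setIntegral_truncatedPower_nonneg α ε W y)
  have hF_le y : F y ≤ A ^ 2 := by
    rw [pow_two]
    exact mul_le_mul (setIntegral_truncatedPower_le hα hε V y)
      (setIntegral_truncatedPower_le hα hε W y) (setIntegral_truncatedPower_nonneg α ε W y)
      ((setIntegral_truncatedPower_nonneg α ε V y).trans
        (setIntegral_truncatedPower_le hα hε V y))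
  have hKm : MeasurableSet (V ∩ W) := hVc.measurableSet.inter hWc.measurableSet
  have hKfin : volume (V ∩ W) < ⊤ :=
    (measure_mono Set.inter_subset_left).trans_lt hVc.measure_lt_top
  have hFint : IntegrableOn F (V ∩ W) :=
    Measure.integrableOn_of_bounded (M := A ^ 2) hKfin.ne
      ((stronglyMeasurable_setIntegral_truncatedPower α ε V).mul
        (stronglyMeasurable_setIntegral_truncatedPower α ε W)).aestronglyMeasurable
      (.of_forall fun y ↦ by rw [Real.norm_of_nonneg (hF_nonneg y)]; exact hF_le y)
  set S := (V ∩ W) \ {x ∈ V ∩ W | ε < Metric.infDist x (frontier (V ∩ W))} with hS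
  have hsub : (∫ y in V ∩ W, F y) - (volume (V ∩ W)).toReal * A ^ 2 = ∫ y in S, (F y - A ^ 2) := by
    rw [← setIntegral_eq_of_subset_of_forall_sdiff_eq_zero hKm Set.sdiff_subset,
      integral_sub hFint (integrableOn_const hKfin.ne), setIntegral_const, smul_eq_mul,
      Measure.real]
    rintro y ⟨hyK, hyS⟩
    have hy : ε < Metric.infDist y (frontier (V ∩ W)) := by
      by_contra hn
      exact hyS ⟨hyK, fun h ↦ hn h.2⟩
    have hball := ball_subset_of_lt_infDist_frontier hε hyK hy
    simp only [hF]
    rw [setIntegral_truncatedPower_of_ball_subset (hball.trans Set.inter_subset_left),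
      setIntegral_truncatedPower_of_ball_subset (hball.trans Set.inter_subset_right), ← hA]
    ring
  calc |(∫ y in V ∩ W, F y) - (volume (V ∩ W)).toReal * A ^ 2|
      = ‖∫ y in S, (F y - A ^ 2)‖ := by rw [hsub, Real.norm_eq_abs]
    _ ≤ A ^ 2 * (volume S).toReal := by
      refine norm_setIntegral_le_of_norm_le_const
        ((measure_mono Set.sdiff_subset).trans_lt hKfin) fun y _ ↦ ?_
      rw [Real.norm_eq_abs, abs_le]
      constructor <;> linarith [hF_nonneg y, hF_le y, sq_nonneg A]
    _ ≤ A ^ 2 * (γ * ε) := by gcongr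
    _ = γ * A ^ 2 * ε := by ring
end
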